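/- Let M be a positive semidefinite real p×p matrix and let x_i, x_j, x_l ∈ ℝᵖ with v = x_l − x_j. Assume c := vᵀ M² v ≠ 0 and Δ := d²_M(x_i, x_l) − d²_M(x_i, x_j) > 0. Then the infimum of ‖x − x_i‖₂² over the adversarial set {x ∈ ℝᵖ : d²_M(x, x_l) ≤ d²_M(x, x_j)} equals Δ²/(4c), and the infimum is attained (namely at the support point x_min = x_i + (Δ/(2c)) · (M v), which lies in the adversarial set). -/

import Mathlib

open Matrix

theorem Matrix.IsSymm.dotProduct_mulVec_comm {n : Type*} [Fintype n] {M : Matrix n n ℝ}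
    (hM : M.IsSymm) (a b : n → ℝ) : a ⬝ᵥ (M *ᵥ b) = b ⬝ᵥ (M *ᵥ a) := by
  rw [dotProduct_mulVec, ← mulVec_transpose, hM.eq, dotProduct_comm]

/-- The difference of the squared distances to two fixed points is affine in the variable point. -/
theorem Matrix.IsSymm.sqDist_sub_sqDist {n : Type*} [Fintype n] {M : Matrix n n ℝ}
    (hM : M.IsSymm) (x y a b : n → ℝ) :
    (x - a) ⬝ᵥ (M *ᵥ (x - a)) - (x - b) ⬝ᵥ (M *ᵥ (x - b)) =
      (y - a) ⬝ᵥ (M *ᵥ (y - a)) - (y - b) ⬝ᵥ (M *ᵥ (y - b))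
        - 2 * ((x - y) ⬝ᵥ (M *ᵥ (a - b))) := by
  simp only [mulVec_sub, dotProduct_sub, sub_dotProduct]
  linarith [hM.dotProduct_mulVec_comm x a, hM.dotProduct_mulVec_comm x b,
    hM.dotProduct_mulVec_comm y a, hM.dotProduct_mulVec_comm y b]

/-- Lower bound for the squared norm of a vector in the half-space `{y | d ≤ 2 ⟨y, w⟩}`. -/
theorem sq_div_le_dotProduct_self {n : Type*} [Fintype n] {y w : n → ℝ} {d : ℝ} (hd : 0 ≤ d)
    (hw : 0 < w ⬝ᵥ w) (h : d ≤ 2 * (y ⬝ᵥ w)) : d ^ 2 / (4 * (w ⬝ᵥ w)) ≤ y ⬝ᵥ y := by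
  have hsq : (y ⬝ᵥ w) ^ 2 ≤ (y ⬝ᵥ y) * (w ⬝ᵥ w) := by
    simpa only [dotProduct, sq] using Finset.sum_mul_sq_le_sq_mul_sq Finset.univ y w
  rw [div_le_iff₀ (by positivity)]
  nlinarith

/-- The infimum of `‖x − x_i‖₂²` over the adversarial set
`{x : d²_M(x,x_l) ≤ d²_M(x,x_j)}` equals `Δ²/(4c)` and is attained at the support point
`x_min = x_i + (Δ/(2c))·(M v)`, which itself lies in the adversarial set. -/
theorem adversarial_margin_is_attained_infimum {p : ℕ}
    (M : Matrix (Fin p) (Fin p) ℝ) (hM : M.PosSemidef)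
    (xi xj xl : Fin p → ℝ)
    (v : Fin p → ℝ) (hv : v = xl - xj)
    (c : ℝ) (hc : c = v ⬝ᵥ ((M * M) *ᵥ v)) (hc0 : c ≠ 0)
    (Δ : ℝ)
    (hΔ : Δ = (xi - xl) ⬝ᵥ (M *ᵥ (xi - xl)) - (xi - xj) ⬝ᵥ (M *ᵥ (xi - xj)))
    (hΔpos : 0 < Δ)
    (xmin : Fin p → ℝ) (hxmin : xmin = xi + (Δ / (2 * c)) • (M *ᵥ v)) :
    IsLeast ((fun x => (x - xi) ⬝ᵥ (x - xi)) ''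
        {x : Fin p → ℝ | (x - xl) ⬝ᵥ (M *ᵥ (x - xl)) ≤ (x - xj) ⬝ᵥ (M *ᵥ (x - xj))})
      (Δ ^ 2 / (4 * c)) ∧
    xmin ∈ {x : Fin p → ℝ | (x - xl) ⬝ᵥ (M *ᵥ (x - xl)) ≤ (x - xj) ⬝ᵥ (M *ᵥ (x - xj))} ∧
    (xmin - xi) ⬝ᵥ (xmin - xi) = Δ ^ 2 / (4 * c) := by
  have hsymm : M.IsSymm := by simpa using hM.isHermitian
  have hcw : c = (M *ᵥ v) ⬝ᵥ (M *ᵥ v) := by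
    rw [hc, ← mulVec_mulVec, hsymm.dotProduct_mulVec_comm]
  have hcpos : 0 < c := by
    refine lt_of_le_of_ne ?_ hc0.symm
    rw [hcw]
    exact Finset.sum_nonneg fun i _ => mul_self_nonneg _
  have hadv (x : Fin p → ℝ) :
      (x - xl) ⬝ᵥ (M *ᵥ (x - xl)) ≤ (x - xj) ⬝ᵥ (M *ᵥ (x - xj)) ↔
        Δ ≤ 2 * ((x - xi) ⬝ᵥ (M *ᵥ v)) := by
    rw [← sub_nonpos, hsymm.sqDist_sub_sqDist x xi, ← hΔ, ← hv, sub_nonpos]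
  have hsub : xmin - xi = (Δ / (2 * c)) • (M *ᵥ v) := by rw [hxmin, add_sub_cancel_left]
  have hmem : (xmin - xl) ⬝ᵥ (M *ᵥ (xmin - xl)) ≤ (xmin - xj) ⬝ᵥ (M *ᵥ (xmin - xj)) := by
    rw [hadv, hsub, smul_dotProduct, ← hcw, smul_eq_mul]
    apply le_of_eq
    field_simp
  have hval : (xmin - xi) ⬝ᵥ (xmin - xi) = Δ ^ 2 / (4 * c) := by
    rw [hsub, smul_dotProduct, dotProduct_smul, ← hcw, smul_eq_mul, smul_eq_mul]
    field_simp
    norm_num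
  refine ⟨⟨⟨xmin, hmem, hval⟩, ?_⟩, hmem, hval⟩
  rintro _ ⟨x, hx, rfl⟩
  rw [hcw]
  exact sq_div_le_dotProduct_self hΔpos.le (hcw ▸ hcpos) ((hadv x).1 hx)
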